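/- Strong normalization of detour reduction: the λ^{□→∧∨}-calculus is strongly normalizing with respect to the one-step detour reduction >_D on well-typed terms, i.e. there is no infinite sequence t₀ >_D t₁ >_D t₂ >_D … starting from a term t₀ that is typable in some context. -/

import Mathlib

namespace IEL

/-- de Bruijn lifting of a renaming under `n` extra binders. -/
def liftRen (n : ℕ) (f : ℕ → ℕ) : ℕ → ℕ :=
  fun j => if j < n then j else f (j - n) + n

/-- Terms of the calculus `λ^{□→∧∨}` in de Bruijn representation.
In `box ts s`, the body `s` is under `ts.length` binders: de Bruijn index `j` in `s`
refers to the binding for `ts[ts.length - 1 - j]` (i.e. `x₁` is the outermost binder). -/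
inductive Tm : Type where
  | var : ℕ → Tm
  | lam : Tm → Tm
  | app : Tm → Tm → Tm
  | pair : Tm → Tm → Tm
  | proj1 : Tm → Tm
  | proj2 : Tm → Tm
  | inl : Tm → Tm
  | inr : Tm → Tm
  | case : Tm → Tm → Tm → Tm
  | box : List Tm → Tm → Tm

def Tm.rename (f : ℕ → ℕ) : Tm → Tm
  | .var n => .var (f n)
  | .lam t => .lam (t.rename (liftRen 1 f))
  | .app t s => .app (t.rename f) (s.rename f)
  | .pair t s => .pair (t.rename f) (s.rename f)
  | .proj1 t => .proj1 (t.rename f)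
  | .proj2 t => .proj2 (t.rename f)
  | .inl t => .inl (t.rename f)
  | .inr t => .inr (t.rename f)
  | .case t a b => .case (t.rename f) (a.rename (liftRen 1 f)) (b.rename (liftRen 1 f))
  | .box ts s => .box (ts.attach.map fun x => x.1.rename f) (s.rename (liftRen ts.length f))
termination_by t => sizeOf t
decreasing_by all_goals simp_wf <;> ((try have := List.sizeOf_lt_of_mem x.2); omega)

def liftSub (n : ℕ) (σ : ℕ → Tm) : ℕ → Tm :=
  fun j => if j < n then .var j else (σ (j - n)).rename (· + n)

def Tm.subst (σ : ℕ → Tm) : Tm → Tm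
  | .var n => σ n
  | .lam t => .lam (t.subst (liftSub 1 σ))
  | .app t s => .app (t.subst σ) (s.subst σ)
  | .pair t s => .pair (t.subst σ) (s.subst σ)
  | .proj1 t => .proj1 (t.subst σ)
  | .proj2 t => .proj2 (t.subst σ)
  | .inl t => .inl (t.subst σ)
  | .inr t => .inr (t.subst σ)
  | .case t a b => .case (t.subst σ) (a.subst (liftSub 1 σ)) (b.subst (liftSub 1 σ))
  | .box ts s => .box (ts.attach.map fun x => x.1.subst σ) (s.subst (liftSub ts.length σ))
termination_by t => sizeOf t
decreasing_by all_goals simp_wf <;> ((try have := List.sizeOf_lt_of_mem x.2); omega)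

/-- `t.subst1 s` is `t[x₀ := s]`. -/
def Tm.subst1 (t s : Tm) : Tm :=
  t.subst (fun j => match j with | 0 => s | j+1 => .var j)

/-- Compatible (contextual) closure of a base relation `R`. -/
inductive Compat (R : Tm → Tm → Prop) : Tm → Tm → Prop where
  | base {t s} : R t s → Compat R t s
  | lam {t t'} : Compat R t t' → Compat R (.lam t) (.lam t')
  | appL {t t' s} : Compat R t t' → Compat R (.app t s) (.app t' s)
  | appR {t s s'} : Compat R s s' → Compat R (.app t s) (.app t s')
  | pairL {t t' s} : Compat R t t' → Compat R (.pair t s) (.pair t' s)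
  | pairR {t s s'} : Compat R s s' → Compat R (.pair t s) (.pair t s')
  | proj1 {t t'} : Compat R t t' → Compat R (.proj1 t) (.proj1 t')
  | proj2 {t t'} : Compat R t t' → Compat R (.proj2 t) (.proj2 t')
  | inl {t t'} : Compat R t t' → Compat R (.inl t) (.inl t')
  | inr {t t'} : Compat R t t' → Compat R (.inr t) (.inr t')
  | case1 {t t' a b} : Compat R t t' → Compat R (.case t a b) (.case t' a b)
  | case2 {t a a' b} : Compat R a a' → Compat R (.case t a b) (.case t a' b)
  | case3 {t a b b'} : Compat R b b' → Compat R (.case t a b) (.case t a b')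
  | boxArg {t t' l₁ l₂ s} : Compat R t t' →
      Compat R (.box (l₁ ++ t :: l₂) s) (.box (l₁ ++ t' :: l₂) s)
  | boxBody {ts s s'} : Compat R s s' → Compat R (.box ts s) (.box ts s')

/-- Renaming used when the body `v` of an inner box is substituted into the outer body:
`v` has `m` bound variables (sent to positions `i, …, i+m-1`) and its ambient free
variables are shifted below the `n - 1 + m` binders of the contractum. -/
def boxRho (i m n : ℕ) : ℕ → ℕ := fun k => if k < m then i + k else k + n - 1

/-- The substitution performed in the box/box detour: the bound variable at de Bruijn
index `i` is replaced by `v` (suitably renamed), the remaining bound variables are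
re-addressed for the enlarged binder list. -/
def boxSigma (i m n : ℕ) (v : Tm) : ℕ → Tm :=
  fun j => if j < i then .var j else if j = i then v.rename (boxRho i m n) else .var (j + m - 1)

/-- Root detour conversions. -/
inductive DRed : Tm → Tm → Prop where
  | beta {t s} : DRed (.app (.lam t) s) (t.subst1 s)
  | projPair1 {t s} : DRed (.proj1 (.pair t s)) t
  | projPair2 {t s} : DRed (.proj2 (.pair t s)) s
  | caseInl {t a b} : DRed (.case (.inl t) a b) (a.subst1 t)
  | caseInr {t a b} : DRed (.case (.inr t) a b) (b.subst1 t)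
  | boxBox {l₁ l₂ us v r} :
      DRed (.box (l₁ ++ (.box us v) :: l₂) r)
           (.box (l₁ ++ us ++ l₂)
                 (r.subst (boxSigma l₂.length us.length (l₁.length + 1 + l₂.length) v)))
  | boxVar {t} : DRed (.box [t] (.var 0)) t

/-- One-step detour reduction `>_D`: the compatible closure of the root detours. -/
def StepD : Tm → Tm → Prop := Compat DRed

/-- Types of `λ^{□→∧∨}`: atoms, `→`, `×`, `+`, `□`. -/
inductive Ty : Type where
  | atom : ℕ → Ty
  | arr : Ty → Ty → Ty
  | prod : Ty → Ty → Ty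
  | sum : Ty → Ty → Ty
  | box : Ty → Ty

/-- Typing judgment `Γ ⊢ t : A` (contexts are lists, position = de Bruijn index). -/
inductive Typing : List Ty → Tm → Ty → Prop where
  | var {Γ n A} : Γ[n]? = some A → Typing Γ (.var n) A
  | lam {Γ t A B} : Typing (A :: Γ) t B → Typing Γ (.lam t) (.arr A B)
  | app {Γ t s A B} : Typing Γ t (.arr A B) → Typing Γ s A → Typing Γ (.app t s) B
  | pair {Γ t s A B} : Typing Γ t A → Typing Γ s B → Typing Γ (.pair t s) (.prod A B)
  | proj1 {Γ t A B} : Typing Γ t (.prod A B) → Typing Γ (.proj1 t) A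
  | proj2 {Γ t A B} : Typing Γ t (.prod A B) → Typing Γ (.proj2 t) B
  | inl {Γ t A B} : Typing Γ t A → Typing Γ (.inl t) (.sum A B)
  | inr {Γ t A B} : Typing Γ t B → Typing Γ (.inr t) (.sum A B)
  | case {Γ t a b A B C} : Typing Γ t (.sum A B) →
      Typing (A :: Γ) a C → Typing (B :: Γ) b C → Typing Γ (.case t a b) C
  | box {Γ ts s As B} : ts.length = As.length →
      (∀ p ∈ List.zip ts As, Typing Γ p.1 (.box p.2)) →
      Typing (As.reverse ++ Γ) s B →
      Typing Γ (.box ts s) (.box B)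

theorem Tm.ind {P : Tm → Prop} (hvar : ∀ n, P (.var n)) (hlam : ∀ t, P t → P (.lam t))
    (happ : ∀ t s, P t → P s → P (.app t s)) (hpair : ∀ t s, P t → P s → P (.pair t s))
    (hp1 : ∀ t, P t → P (.proj1 t)) (hp2 : ∀ t, P t → P (.proj2 t))
    (hinl : ∀ t, P t → P (.inl t)) (hinr : ∀ t, P t → P (.inr t))
    (hcase : ∀ t a b, P t → P a → P b → P (.case t a b))
    (hbox : ∀ ts s, (∀ t ∈ ts, P t) → P s → P (.box ts s)) : ∀ t, P t
  | .var n => hvar n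
  | .lam t => hlam t (Tm.ind hvar hlam happ hpair hp1 hp2 hinl hinr hcase hbox t)
  | .app t s => happ t s (Tm.ind hvar hlam happ hpair hp1 hp2 hinl hinr hcase hbox t)
      (Tm.ind hvar hlam happ hpair hp1 hp2 hinl hinr hcase hbox s)
  | .pair t s => hpair t s (Tm.ind hvar hlam happ hpair hp1 hp2 hinl hinr hcase hbox t)
      (Tm.ind hvar hlam happ hpair hp1 hp2 hinl hinr hcase hbox s)
  | .proj1 t => hp1 t (Tm.ind hvar hlam happ hpair hp1 hp2 hinl hinr hcase hbox t)
  | .proj2 t => hp2 t (Tm.ind hvar hlam happ hpair hp1 hp2 hinl hinr hcase hbox t)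
  | .inl t => hinl t (Tm.ind hvar hlam happ hpair hp1 hp2 hinl hinr hcase hbox t)
  | .inr t => hinr t (Tm.ind hvar hlam happ hpair hp1 hp2 hinl hinr hcase hbox t)
  | .case t a b => hcase t a b (Tm.ind hvar hlam happ hpair hp1 hp2 hinl hinr hcase hbox t)
      (Tm.ind hvar hlam happ hpair hp1 hp2 hinl hinr hcase hbox a)
      (Tm.ind hvar hlam happ hpair hp1 hp2 hinl hinr hcase hbox b)
  | .box ts s => hbox ts s
      (fun t _ => Tm.ind hvar hlam happ hpair hp1 hp2 hinl hinr hcase hbox t)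
      (Tm.ind hvar hlam happ hpair hp1 hp2 hinl hinr hcase hbox s)

theorem rename_box (f : ℕ → ℕ) (ts s) : (Tm.box ts s).rename f =
    .box (ts.map (Tm.rename f)) (s.rename (liftRen ts.length f)) := by
  simp [Tm.rename]

theorem subst_box (f : ℕ → Tm) (ts s) : (Tm.box ts s).subst f =
    .box (ts.map (Tm.subst f)) (s.subst (liftSub ts.length f)) := by
  simp [Tm.subst]

theorem liftSub_var (n : ℕ) (f : ℕ → ℕ) :
    liftSub n (fun j => .var (f j)) = fun j => .var (liftRen n f j) := by
  funext j
  simp only [liftSub, liftRen]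
  split_ifs <;> simp [Tm.rename]

theorem rename_eq_subst (t : Tm) : ∀ f : ℕ → ℕ, t.rename f = t.subst (fun j => .var (f j)) := by
  induction t using Tm.ind with
  | hbox ts s ih1 ih2 =>
    intro f
    rw [rename_box, subst_box, liftSub_var, ih2]
    congr 1
    exact List.map_congr_left fun t ht => ih1 t ht f
  | _ => intros; simp_all [Tm.rename, Tm.subst, liftSub_var]

theorem rename_subst (t : Tm) : ∀ (f : ℕ → ℕ) (σ : ℕ → Tm),
    (t.rename f).subst σ = t.subst (fun j => σ (f j)) := by
  have key : ∀ n (f : ℕ → ℕ) (σ : ℕ → Tm),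
      (fun j => liftSub n σ (liftRen n f j)) = liftSub n (fun j => σ (f j)) := by
    intro n f σ
    funext j
    simp only [liftSub, liftRen]
    split_ifs <;> first | rfl | omega | simp
  induction t using Tm.ind with
  | hbox ts s ih1 ih2 =>
    intro f σ
    rw [rename_box, subst_box, subst_box, ih2, List.length_map, key, List.map_map]
    congr 1
    exact List.map_congr_left fun t ht => ih1 t ht f σ
  | _ => intros; simp_all [Tm.rename, Tm.subst]

theorem rename_rename (t : Tm) (f g : ℕ → ℕ) :
    (t.rename f).rename g = t.rename (fun j => g (f j)) := by
  rw [rename_eq_subst _ g, rename_subst, rename_eq_subst]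

theorem subst_rename (t : Tm) : ∀ (σ : ℕ → Tm) (f : ℕ → ℕ),
    (t.subst σ).rename f = t.subst (fun j => (σ j).rename f) := by
  have key : ∀ n (σ : ℕ → Tm) (f : ℕ → ℕ),
      (fun j => (liftSub n σ j).rename (liftRen n f)) = liftSub n (fun j => (σ j).rename f) := by
    intro n σ f
    funext j
    simp only [liftSub]
    split_ifs with h
    · simp [Tm.rename, liftRen, h]
    · simp [rename_rename, liftRen]
  induction t using Tm.ind with
  | hbox ts s ih1 ih2 =>
    intro f σ
    rw [subst_box, rename_box, subst_box, ih2, List.length_map, key, List.map_map]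
    congr 1
    exact List.map_congr_left fun t ht => ih1 t ht f σ
  | _ => intros; simp_all [Tm.rename, Tm.subst]

theorem subst_subst (t : Tm) : ∀ (σ τ : ℕ → Tm),
    (t.subst σ).subst τ = t.subst (fun j => (σ j).subst τ) := by
  have key : ∀ n (σ τ : ℕ → Tm),
      (fun j => (liftSub n σ j).subst (liftSub n τ)) = liftSub n (fun j => (σ j).subst τ) := by
    intro n σ τ
    funext j
    simp only [liftSub]
    split_ifs with h
    · simp [Tm.subst, liftSub, h]
    · simp [rename_subst, subst_rename, liftSub]
  induction t using Tm.ind with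
  | hbox ts s ih1 ih2 =>
    intro f σ
    rw [subst_box, subst_box, subst_box, ih2, List.length_map, key, List.map_map]
    congr 1
    exact List.map_congr_left fun t ht => ih1 t ht f σ
  | _ => intros; simp_all [Tm.subst]

theorem subst_var (t : Tm) : t.subst Tm.var = t := by
  have key : ∀ n, liftSub n Tm.var = Tm.var := by
    intro n
    have := liftSub_var n id
    simp only [id] at this
    refine this.trans ?_
    funext j
    simp only [liftRen]
    split_ifs <;> simp
    omega
  induction t using Tm.ind with
  | hbox ts s ih1 ih2 =>
    rw [subst_box, key, ih2]
    congr 1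
    exact (List.map_congr_left fun t ht => ih1 t ht).trans (List.map_id' _)
  | _ => simp_all [Tm.subst]

theorem rename_id (t : Tm) : t.rename (fun j => j) = t := by
  rw [rename_eq_subst]; exact subst_var t

theorem subst_congr (t : Tm) {σ τ : ℕ → Tm} (h : ∀ j, σ j = τ j) : t.subst σ = t.subst τ := by
  rw [funext h]

/-- Contractions at two different arguments of a box commute. -/
theorem sigma_comm (r v v2 : Tm) {i k m m2 n k' n' n'' : ℕ} (h1 : i < k) (h2 : k < n)
    (hk : k' = k + m - 1) (hn : n' = n - 1 + m) (hn2 : n'' = n - 1 + m2) :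
    (r.subst (boxSigma i m n v)).subst (boxSigma k' m2 n' v2) =
    (r.subst (boxSigma k m2 n v2)).subst (boxSigma i m n'' v) := by
  subst hk hn hn2
  rw [subst_subst, subst_subst]
  refine subst_congr _ fun j => ?_
  rcases lt_trichotomy j i with h | h | h
  · have : j < k := by omega
    have : j < k + m - 1 := by omega
    simp [boxSigma, Tm.subst, *]
  · subst h
    simp only [boxSigma, Tm.subst, h1, if_true, lt_irrefl, if_false]
    rw [rename_subst, rename_eq_subst]
    refine subst_congr _ fun l => ?_
    simp only [boxRho, boxSigma]
    split_ifs <;> first | omega | rfl | (congr 1; omega)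
  · rcases lt_trichotomy j k with h' | h' | h'
    · have a1 : ¬ j < i := by omega
      have a2 : j ≠ i := by omega
      have a3 : j + m - 1 < k + m - 1 := by omega
      simp [boxSigma, Tm.subst, *]
    · subst h'
      have a1 : ¬ j < i := by omega
      have a2 : j ≠ i := by omega
      simp only [boxSigma, Tm.subst, a1, a2, if_true, lt_irrefl, if_false]
      rw [rename_subst, rename_eq_subst]
      refine subst_congr _ fun l => ?_
      simp only [boxRho, boxSigma]
      split_ifs <;> first | omega | rfl | (congr 1; omega)
    · have a1 : ¬ j < i := by omega
      have a2 : j ≠ i := by omega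
      have a3 : ¬ j < k := by omega
      have a4 : j ≠ k := by omega
      simp only [boxSigma, Tm.subst, a1, a2, a3, a4, if_false]
      split_ifs <;> first | omega | rfl | (congr 1; omega)

/-- Contraction inside the inner box versus after merging. -/
theorem sigma_nest (r v v2 : Tm) {i k m m2 n k' n' m' : ℕ} (h1 : i < n) (h2 : k < m)
    (hk : k' = i + k) (hn : n' = n - 1 + m) (hm : m' = m - 1 + m2) :
    (r.subst (boxSigma i m n v)).subst (boxSigma k' m2 n' v2) =
    r.subst (boxSigma i m' n (v.subst (boxSigma k m2 m v2))) := by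
  subst hk hn hm
  rw [subst_subst]
  refine subst_congr _ fun j => ?_
  rcases lt_trichotomy j i with h | h | h
  · have : j < i + k := by omega
    simp [boxSigma, Tm.subst, *]
  · subst h
    simp only [boxSigma, if_true, lt_irrefl, if_false]
    rw [rename_subst, subst_rename]
    refine subst_congr _ fun l => ?_
    simp only [boxRho, boxSigma]
    split_ifs <;> first
      | omega
      | (simp only [Tm.rename, boxRho]; split_ifs <;> first | omega | rfl | (congr 1; omega))
      | (rw [rename_rename]; congr 1; funext x; simp only [boxRho]; split_ifs <;> omega)
  · have a1 : ¬ j < i := by omega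
    have a2 : j ≠ i := by omega
    simp only [boxSigma, Tm.subst, a1, a2, if_false]
    split_ifs <;> first | omega | rfl | (congr 1; omega)

theorem sigma_lift (r v : Tm) (σ : ℕ → Tm) {i m n n' : ℕ} (h1 : i < n) (hn : n' = n - 1 + m) :
    (r.subst (boxSigma i m n v)).subst (liftSub n' σ) =
    (r.subst (liftSub n σ)).subst (boxSigma i m n (v.subst (liftSub m σ))) := by
  subst hn
  rw [subst_subst, subst_subst]
  refine subst_congr _ fun j => ?_
  rcases lt_trichotomy j i with h | h | h
  · have a : j < n := by omega
    have b : j < n - 1 + m := by omega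
    simp [boxSigma, liftSub, Tm.subst, *]
  · subst h
    simp only [boxSigma, liftSub, h1, Tm.subst, if_true, lt_irrefl, if_false]
    rw [rename_subst, subst_rename]
    refine subst_congr _ fun l => ?_
    by_cases hl : l < m
    · have : j + l < n - 1 + m := by omega
      simp [boxRho, liftSub, hl, this, Tm.rename]
    · have h3 : ¬ (l + n - 1 < n - 1 + m) := by omega
      simp only [boxRho, liftSub, hl, h3, if_false, rename_rename]
      have h4 : l + n - 1 - (n - 1 + m) = l - m := by omega
      rw [h4]
      congr 1
      funext x
      split_ifs <;> omega
  · have a1 : ¬ j < i := by omega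
    have a2 : j ≠ i := by omega
    by_cases hj : j < n
    · have : j + m - 1 < n - 1 + m := by omega
      simp [boxSigma, liftSub, Tm.subst, *]
    · have h3 : ¬ (j + m - 1 < n - 1 + m) := by omega
      have h4 : j + m - 1 - (n - 1 + m) = j - n := by omega
      simp only [boxSigma, liftSub, Tm.subst, a1, a2, hj, h3, h4, if_false, rename_subst]
      rw [rename_eq_subst]
      refine subst_congr _ fun l => ?_
      split_ifs <;> first | omega | (congr 1; omega)

theorem subst1_subst (t s : Tm) (σ : ℕ → Tm) :
    (t.subst1 s).subst σ = (t.subst (liftSub 1 σ)).subst1 (s.subst σ) := by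
  simp only [Tm.subst1, subst_subst]
  refine subst_congr _ fun j => ?_
  cases j with
  | zero => simp [liftSub, Tm.subst]
  | succ j => simp [liftSub, Tm.subst, rename_subst, subst_var]

theorem step_subst {t t' : Tm} (h : StepD t t') : ∀ σ, StepD (t.subst σ) (t'.subst σ) := by
  induction h with
  | base h =>
    intro σ
    cases h with
    | beta => rw [subst1_subst]; simp only [Tm.subst]; exact .base .beta
    | projPair1 => simp only [Tm.subst]; exact .base .projPair1
    | projPair2 => simp only [Tm.subst]; exact .base .projPair2
    | caseInl => rw [subst1_subst]; simp only [Tm.subst]; exact .base .caseInl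
    | caseInr => rw [subst1_subst]; simp only [Tm.subst]; exact .base .caseInr
    | @boxBox l₁ l₂ us v r =>
      have := DRed.boxBox (l₁ := l₁.map (Tm.subst σ)) (l₂ := l₂.map (Tm.subst σ))
        (us := us.map (Tm.subst σ)) (v := v.subst (liftSub us.length σ))
        (r := r.subst (liftSub (l₁.length + 1 + l₂.length) σ))
      simp only [List.length_map] at this
      rw [← sigma_lift (n' := (l₁ ++ us ++ l₂).length)] at this
      · simp only [subst_box, List.map_append, List.map_cons, List.length_append, List.length_cons]
        rw [show l₁.length + (l₂.length + 1) = l₁.length + 1 + l₂.length by omega]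
        simp only [List.length_append] at this
        exact .base this
      · omega
      · simp; omega
    | boxVar => rw [subst_box]; simp [liftSub, Tm.subst]; exact .base .boxVar
  | lam _ ih => intro σ; simp only [Tm.subst]; exact .lam (ih _)
  | appL _ ih => intro σ; simp only [Tm.subst]; exact .appL (ih _)
  | appR _ ih => intro σ; simp only [Tm.subst]; exact .appR (ih _)
  | pairL _ ih => intro σ; simp only [Tm.subst]; exact .pairL (ih _)
  | pairR _ ih => intro σ; simp only [Tm.subst]; exact .pairR (ih _)
  | proj1 _ ih => intro σ; simp only [Tm.subst]; exact .proj1 (ih _)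
  | proj2 _ ih => intro σ; simp only [Tm.subst]; exact .proj2 (ih _)
  | inl _ ih => intro σ; simp only [Tm.subst]; exact .inl (ih _)
  | inr _ ih => intro σ; simp only [Tm.subst]; exact .inr (ih _)
  | case1 _ ih => intro σ; simp only [Tm.subst]; exact .case1 (ih _)
  | case2 _ ih => intro σ; simp only [Tm.subst]; exact .case2 (ih _)
  | case3 _ ih => intro σ; simp only [Tm.subst]; exact .case3 (ih _)
  | boxArg _ ih =>
    intro σ
    simp only [subst_box, List.map_append, List.map_cons, List.length_append, List.length_cons]
    exact .boxArg (ih _)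
  | boxBody _ ih => intro σ; simp only [subst_box]; exact .boxBody (ih _)

theorem step_rename {t t' : Tm} (h : StepD t t') (f : ℕ → ℕ) :
    StepD (t.rename f) (t'.rename f) := by
  simp only [rename_eq_subst]; exact step_subst h _

/-- Many-step reduction. -/
abbrev Steps : Tm → Tm → Prop := Relation.ReflTransGen StepD

theorem steps_cong {c : Tm → Tm} (hc : ∀ {a b}, StepD a b → StepD (c a) (c b)) {a b}
    (h : Steps a b) : Steps (c a) (c b) := h.lift c fun _ _ => hc

theorem steps_box_args {ts ts' : List Tm} (h : List.Forall₂ Steps ts ts') :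
    ∀ (l : List Tm) s, Steps (.box (l ++ ts) s) (.box (l ++ ts') s) := by
  induction h with
  | nil => intros; exact .refl
  | @cons a b l1 l2 hab _ ih =>
    intro l s
    refine (steps_cong (c := fun x => .box (l ++ x :: l1) s) (fun h => .boxArg h) hab).trans ?_
    simpa using ih (l ++ [b]) s

theorem steps_sub (t : Tm) : ∀ {σ τ : ℕ → Tm}, (∀ j, Steps (σ j) (τ j)) →
    Steps (t.subst σ) (t.subst τ) := by
  have key : ∀ n {σ τ : ℕ → Tm}, (∀ j, Steps (σ j) (τ j)) →
      ∀ j, Steps (liftSub n σ j) (liftSub n τ j) := by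
    intro n σ τ h j
    simp only [liftSub]
    split_ifs
    · exact .refl
    · exact steps_cong (fun h => step_rename h _) (h _)
  induction t using Tm.ind with
  | hvar n => intro σ τ h; simpa [Tm.subst] using h n
  | hlam t ih =>
    intro σ τ h; simp only [Tm.subst]
    exact steps_cong (fun h => .lam h) (ih (key 1 h))
  | happ t s ih1 ih2 =>
    intro σ τ h; simp only [Tm.subst]
    exact (steps_cong (c := fun x => .app x _) (fun h => .appL h) (ih1 h)).trans
      (steps_cong (fun h => .appR h) (ih2 h))
  | hpair t s ih1 ih2 =>
    intro σ τ h; simp only [Tm.subst]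
    exact (steps_cong (c := fun x => .pair x _) (fun h => .pairL h) (ih1 h)).trans
      (steps_cong (fun h => .pairR h) (ih2 h))
  | hp1 t ih =>
    intro σ τ h; simp only [Tm.subst]
    exact steps_cong (fun h => .proj1 h) (ih h)
  | hp2 t ih =>
    intro σ τ h; simp only [Tm.subst]
    exact steps_cong (fun h => .proj2 h) (ih h)
  | hinl t ih =>
    intro σ τ h; simp only [Tm.subst]
    exact steps_cong (fun h => .inl h) (ih h)
  | hinr t ih =>
    intro σ τ h; simp only [Tm.subst]
    exact steps_cong (fun h => .inr h) (ih h)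
  | hcase t a b ih1 ih2 ih3 =>
    intro σ τ h; simp only [Tm.subst]
    exact ((steps_cong (c := fun x => .case x _ _) (fun h => .case1 h) (ih1 h)).trans
      (steps_cong (c := fun x => .case _ x _) (fun h => .case2 h) (ih2 (key 1 h)))).trans
      (steps_cong (fun h => .case3 h) (ih3 (key 1 h)))
  | hbox ts s ih1 ih2 =>
    intro σ τ h; simp only [subst_box]
    refine Relation.ReflTransGen.trans ?_ (steps_cong (fun h => .boxBody h) (ih2 (key _ h)))
    refine steps_box_args (l := []) ?_ _
    rw [List.forall₂_map_left_iff, List.forall₂_map_right_iff, List.forall₂_same]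
    exact fun t ht => ih1 t ht h

/-- Strong normalization. -/
abbrev SN (t : Tm) : Prop := Acc (fun a b : Tm => StepD b a) t

theorem SN.step {t t' : Tm} (h : SN t) (s : StepD t t') : SN t' := h.inv s

theorem SN.steps {t t' : Tm} (h : SN t) (s : Steps t t') : SN t' := by
  induction s with
  | refl => exact h
  | tail _ s ih => exact ih.step s

theorem SN.of_cong {c : Tm → Tm} (hc : ∀ {a b}, StepD a b → StepD (c a) (c b)) {t}
    (h : SN (c t)) : SN t := by
  generalize hx : c t = x at h
  induction h generalizing t with
  | intro x _ ih => subst hx; exact ⟨_, fun y hy => ih _ (hc hy) rfl⟩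

theorem SN.of_subst {t : Tm} {σ} (h : SN (t.subst σ)) : SN t :=
  SN.of_cong (c := fun t => t.subst σ) (fun h => step_subst h σ) h

theorem split_cases {α : Type*} {l₁ l₂ k₁ k₂ : List α} {a b : α}
    (h : l₁ ++ a :: l₂ = k₁ ++ b :: k₂) :
    (l₁ = k₁ ∧ a = b ∧ l₂ = k₂) ∨ (∃ m, k₁ = l₁ ++ a :: m ∧ l₂ = m ++ b :: k₂) ∨
    (∃ m, l₁ = k₁ ++ b :: m ∧ k₂ = m ++ a :: l₂) := by
  rcases List.append_eq_append_iff.1 h with ⟨m, h1, h2⟩ | ⟨m, h1, h2⟩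
  · cases m with
    | nil => simp_all
    | cons c m => simp_all
  · cases m with
    | nil => simp_all
    | cons c m => simp_all

theorem box_inv {ts : List Tm} {s q : Tm} (h : StepD (.box ts s) q) :
    (∃ l₁ t t' l₂, ts = l₁ ++ t :: l₂ ∧ StepD t t' ∧ q = .box (l₁ ++ t' :: l₂) s) ∨
    (∃ s', StepD s s' ∧ q = .box ts s') ∨
    (∃ l₁ us v l₂, ts = l₁ ++ (.box us v) :: l₂ ∧ q = .box (l₁ ++ us ++ l₂)
      (s.subst (boxSigma l₂.length us.length (l₁.length + 1 + l₂.length) v))) ∨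
    (ts = [q] ∧ s = .var 0) := by
  generalize hx : Tm.box ts s = x at h
  cases h with
  | base h =>
    cases h with
    | boxBox =>
      cases hx
      exact Or.inr (Or.inr (Or.inl ⟨_, _, _, _, rfl, rfl⟩))
    | boxVar => cases hx; simp
    | _ => cases hx
  | boxArg h => cases hx; exact Or.inl ⟨_, _, _, _, rfl, h, rfl⟩
  | boxBody h => cases hx; exact Or.inr (Or.inl ⟨_, h, rfl⟩)
  | _ => cases hx

/-- The result of merging a box `us, v` into the hole of `l₁, _, l₂` with body `r`. -/
def merge (l₁ l₂ : List Tm) (r : Tm) (us : List Tm) (v : Tm) : Tm :=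
  .box (l₁ ++ us ++ l₂) (r.subst (boxSigma l₂.length us.length (l₁.length + 1 + l₂.length) v))

theorem hole_inv {l₁ l₂ : List Tm} {t r q : Tm} (h : StepD (.box (l₁ ++ t :: l₂) r) q) :
    (∃ t', StepD t t' ∧ q = .box (l₁ ++ t' :: l₂) r) ∨
    (∃ k₁ k₂ r', q = .box (k₁ ++ t :: k₂) r' ∧
      ∀ us v, StepD (merge l₁ l₂ r us v) (merge k₁ k₂ r' us v)) ∨
    (∃ us v, t = .box us v ∧ q = merge l₁ l₂ r us v) ∨
    (l₁ = [] ∧ l₂ = [] ∧ r = .var 0 ∧ q = t) := by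
  rcases box_inv h with ⟨k₁, u, u', k₂, he, hs, rfl⟩ | ⟨s', hs, rfl⟩ | ⟨k₁, ws, w, k₂, he, rfl⟩ |
    ⟨he, rfl⟩
  · rcases split_cases he with ⟨rfl, rfl, rfl⟩ | ⟨m, rfl, rfl⟩ | ⟨m, rfl, rfl⟩
    · exact Or.inl ⟨u', hs, rfl⟩
    · refine Or.inr (Or.inl ⟨l₁, m ++ u' :: k₂, r, by simp, fun us v => ?_⟩)
      have := Compat.boxArg (l₁ := l₁ ++ us ++ m) (l₂ := k₂) (s := r.subst (boxSigma
        (m ++ u' :: k₂).length us.length (l₁.length + 1 + (m ++ u' :: k₂).length) v)) hs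
      simpa [merge, StepD] using this
    · refine Or.inr (Or.inl ⟨k₁ ++ u' :: m, l₂, r, by simp, fun us v => ?_⟩)
      have := Compat.boxArg (l₁ := k₁) (l₂ := m ++ us ++ l₂) (s := r.subst (boxSigma
        l₂.length us.length ((k₁ ++ u' :: m).length + 1 + l₂.length) v)) hs
      simpa [merge, StepD] using this
  · exact Or.inr (Or.inl ⟨l₁, l₂, s', rfl, fun us v => .boxBody (step_subst hs _)⟩)
  · rcases split_cases he with ⟨rfl, rfl, rfl⟩ | ⟨m, rfl, rfl⟩ | ⟨m, rfl, rfl⟩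
    · exact Or.inr (Or.inr (Or.inl ⟨ws, w, rfl, rfl⟩))
    · refine Or.inr (Or.inl ⟨l₁, m ++ ws ++ k₂, _, by simp; rfl, fun us v => ?_⟩)
      have := DRed.boxBox (l₁ := l₁ ++ us ++ m) (l₂ := k₂) (us := ws) (v := w)
        (r := r.subst (boxSigma (m ++ .box ws w :: k₂).length us.length
          (l₁.length + 1 + (m ++ .box ws w :: k₂).length) v))
      rw [← sigma_comm (i := k₂.length) (k := (m ++ .box ws w :: k₂).length)
        (n := l₁.length + 1 + (m ++ .box ws w :: k₂).length)
        (k' := (m ++ ws ++ k₂).length) (n' := l₁.length + 1 + (m ++ ws ++ k₂).length)] at this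
      · have := Compat.base this
        simpa [merge, StepD, add_assoc, add_comm, add_left_comm] using this
      all_goals simp
      all_goals omega
    · refine Or.inr (Or.inl ⟨k₁ ++ ws ++ m, l₂, _, by simp; rfl, fun us v => ?_⟩)
      have := DRed.boxBox (l₁ := k₁) (l₂ := m ++ us ++ l₂) (us := ws) (v := w)
        (r := r.subst (boxSigma l₂.length us.length
          ((k₁ ++ .box ws w :: m).length + 1 + l₂.length) v))
      rw [sigma_comm (i := l₂.length) (k := (m ++ t :: l₂).length)
        (n := (k₁ ++ .box ws w :: m).length + 1 + l₂.length)
        (n'' := (k₁ ++ ws ++ m).length + 1 + l₂.length)] at this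
      · have := Compat.base this
        simpa [merge, StepD, add_assoc, add_comm, add_left_comm] using this
      all_goals simp
      all_goals omega
  · have : l₁ = [] ∧ l₂ = [] ∧ t = q := by
      cases l₁ <;> simp_all
    exact Or.inr (Or.inr (Or.inr ⟨this.1, this.2.1, rfl, this.2.2.symm⟩))

theorem merge_box_inv {us : List Tm} {v q : Tm} (h : StepD (.box us v) q) :
    (∃ us' v', q = .box us' v' ∧ ∀ l₁ l₂ r, Steps (merge l₁ l₂ r us v) (merge l₁ l₂ r us' v')) ∨
    (us = [q] ∧ v = .var 0) := by
  rcases box_inv h with ⟨k₁, u, u', k₂, rfl, hs, rfl⟩ | ⟨s', hs, rfl⟩ |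
    ⟨k₁, ws, w, k₂, rfl, rfl⟩ | h
  · refine Or.inl ⟨_, _, rfl, fun l₁ l₂ r => .single ?_⟩
    have := Compat.boxArg (l₁ := l₁ ++ k₁) (l₂ := k₂ ++ l₂) (s := r.subst (boxSigma
        l₂.length (k₁ ++ u' :: k₂).length (l₁.length + 1 + l₂.length) v)) hs
    simpa [merge, StepD] using this
  · refine Or.inl ⟨_, _, rfl, fun l₁ l₂ r => steps_cong (fun h => .boxBody h) (steps_sub _ ?_)⟩
    intro j
    simp only [boxSigma]
    split_ifs
    · exact .refl
    · exact .single (step_rename hs _)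
    · exact .refl
  · refine Or.inl ⟨_, _, rfl, fun l₁ l₂ r => .single ?_⟩
    have := DRed.boxBox (l₁ := l₁ ++ k₁) (l₂ := k₂ ++ l₂) (us := ws) (v := w)
      (r := r.subst (boxSigma l₂.length (k₁ ++ .box ws w :: k₂).length
        (l₁.length + 1 + l₂.length) v))
    rw [sigma_nest (k := k₂.length) (m' := (k₁ ++ ws ++ k₂).length)] at this
    · have := Compat.base this
      simpa [merge, StepD, add_assoc, add_comm, add_left_comm] using this
    all_goals simp
    all_goals omega
  · exact Or.inr h

theorem merge_var (l₁ l₂ : List Tm) (r t : Tm) :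
    merge l₁ l₂ r [t] (.var 0) = .box (l₁ ++ t :: l₂) r := by
  have : boxSigma l₂.length [t].length (l₁.length + 1 + l₂.length) (.var 0) = Tm.var := by
    funext j
    simp only [boxSigma, Tm.rename, boxRho]
    split_ifs <;> simp_all
  unfold merge
  rw [this, subst_var]
  simp

/-- Head expansion for the box-box detour. -/
theorem expansion {t : Tm} (ht : SN t) : ∀ {us v}, t = .box us v → ∀ {l₁ l₂ r},
    SN (merge l₁ l₂ r us v) → SN (.box (l₁ ++ t :: l₂) r) := by
  induction ht with
  | intro t hacc ih =>
    rintro us v rfl l₁ l₂ r hm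
    generalize hx : merge l₁ l₂ r us v = x at hm
    induction hm generalizing l₁ l₂ r with
    | intro x hx' ih2 =>
      subst hx
      have hm : SN (merge l₁ l₂ r us v) := ⟨_, hx'⟩
      refine ⟨_, fun q hq => ?_⟩
      rcases hole_inv hq with ⟨t', hs, rfl⟩ | ⟨k₁, k₂, r', rfl, hs⟩ | ⟨us', v', he, rfl⟩ |
        ⟨rfl, rfl, rfl, rfl⟩
      · rcases merge_box_inv hs with ⟨us', v', rfl, hst⟩ | ⟨rfl, rfl⟩
        · exact ih _ hs rfl (hm.steps (hst _ _ _))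
        · rwa [merge_var] at hm
      · exact ih2 _ (hs _ _) rfl
      · cases he; exact hm
      · exact ⟨_, hacc⟩

/-- Reducibility. -/
def Red : Ty → Tm → Prop
  | .atom _, t => SN t
  | .arr A B, t => ∀ s, Red A s → Red B (.app t s)
  | .prod A B, t => Red A (.proj1 t) ∧ Red B (.proj2 t)
  | .sum A B, t => SN t ∧ (∀ u, Steps t (.inl u) → Red A u) ∧ (∀ u, Steps t (.inr u) → Red B u)
  | .box A, t => ∀ l₁ l₂ r, (∀ a, Red A a → SN (merge l₁ l₂ r [] a)) →
      SN (.box (l₁ ++ t :: l₂) r)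

/-- Neutral terms. -/
def Neutral : Tm → Prop
  | .var _ => True
  | .app _ _ => True
  | .proj1 _ => True
  | .proj2 _ => True
  | .case _ _ _ => True
  | _ => False

theorem sn_box_nil {t : Tm} (h : SN t) : SN (.box [] t) := by
  induction h with
  | intro t _ ih =>
    refine ⟨_, fun q hq => ?_⟩
    rcases box_inv hq with ⟨_, _, _, _, h, _⟩ | ⟨s', hs, rfl⟩ | ⟨_, _, _, _, h, _⟩ | ⟨h, _⟩
    · simp at h
    · exact ih _ hs
    · simp at h
    · simp at h

theorem merge_self (us : List Tm) (v : Tm) : merge [] [] (.var 0) us v = .box us v := by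
  have : v.rename (boxRho 0 us.length 1) = v := by
    have : boxRho 0 us.length 1 = fun j => j := by
      funext j; simp [boxRho]
    rw [this, rename_id]
  simp [merge, Tm.subst, boxSigma, this]

theorem red_cr (A : Ty) : (∀ t, Red A t → SN t) ∧ (∀ t t', Red A t → StepD t t' → Red A t') ∧
    (∀ t, Neutral t → (∀ t', StepD t t' → Red A t') → Red A t) := by
  induction A with
  | atom n => exact ⟨fun t h => h, fun t t' h s => SN.step h s, fun t _ h => ⟨_, h⟩⟩
  | arr A B ihA ihB =>
    obtain ⟨a1, a2, a3⟩ := ihA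
    obtain ⟨b1, b2, b3⟩ := ihB
    have hv : Red A (.var 0) := a3 _ trivial (by rintro _ (h | h); cases h)
    refine ⟨fun t h => ?_, fun t t' h s u hu => b2 _ _ (h u hu) (.appL s), fun t hn h u hu => ?_⟩
    · exact SN.of_cong (c := fun t => .app t (.var 0)) (fun h => .appL h) (b1 _ (h _ hv))
    · have hsn := a1 u hu
      induction hsn with
      | intro u _ ih =>
        refine b3 _ trivial fun q hq => ?_
        cases hq with
        | base hb => cases hb; exact hn.elim
        | appL hs => exact h _ hs _ hu
        | appR hs => exact ih _ hs (a2 _ _ hu hs)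
  | prod A B ihA ihB =>
    obtain ⟨a1, a2, a3⟩ := ihA
    obtain ⟨b1, b2, b3⟩ := ihB
    refine ⟨fun t h => ?_, fun t t' h s => ⟨a2 _ _ h.1 (.proj1 s), b2 _ _ h.2 (.proj2 s)⟩,
      fun t hn h => ⟨a3 _ trivial fun q hq => ?_, b3 _ trivial fun q hq => ?_⟩⟩
    · exact SN.of_cong (c := fun t => .proj1 t) (fun h => .proj1 h) (a1 _ h.1)
    · cases hq with
      | base hb => cases hb; exact hn.elim
      | proj1 hs => exact (h _ hs).1
    · cases hq with
      | base hb => cases hb; exact hn.elim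
      | proj2 hs => exact (h _ hs).2
  | sum A B ihA ihB =>
    refine ⟨fun t h => h.1, fun t t' h s => ⟨h.1.step s, fun u hu => h.2.1 u (.head s hu),
      fun u hu => h.2.2 u (.head s hu)⟩, fun t hn h => ⟨⟨_, fun q hq => (h q hq).1⟩, ?_, ?_⟩⟩
    · intro u hu
      rcases Relation.ReflTransGen.cases_head hu with rfl | ⟨q, hq, hs⟩
      · exact hn.elim
      · exact (h q hq).2.1 u hs
    · intro u hu
      rcases Relation.ReflTransGen.cases_head hu with rfl | ⟨q, hq, hs⟩
      · exact hn.elim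
      · exact (h q hq).2.2 u hs
  | box A ihA =>
    obtain ⟨a1, a2, a3⟩ := ihA
    have hv : Red A (.var 0) := a3 _ trivial (by rintro _ (h | h); cases h)
    have sn : ∀ t, Red (.box A) t → SN t := fun t h => by
      have := h [] [] (.var 0) fun a ha => by
        rw [merge_self]; exact sn_box_nil (a1 a ha)
      exact this.step (.base .boxVar)
    refine ⟨sn, fun t t' h s l₁ l₂ r H => (h l₁ l₂ r H).step (.boxArg s),
      fun t hn h l₁ l₂ r H => ?_⟩
    have hm := H _ hv
    generalize hx : merge l₁ l₂ r [] (.var 0) = x at hm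
    induction hm generalizing l₁ l₂ r with
    | intro x _ ih =>
      subst hx
      refine ⟨_, fun q hq => ?_⟩
      rcases hole_inv hq with ⟨t', hs, rfl⟩ | ⟨k₁, k₂, r', rfl, hs⟩ | ⟨us', v', rfl, rfl⟩ |
        ⟨rfl, rfl, rfl, rfl⟩
      · exact h _ hs _ _ _ H
      · exact ih _ (hs _ _) _ _ _ (fun a ha => (H a ha).step (hs _ _)) rfl
      · exact hn.elim
      · exact ⟨_, fun q hq => sn _ (h _ hq)⟩

theorem Red.sn {A t} (h : Red A t) : SN t := (red_cr A).1 t h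
theorem Red.step {A t t'} (h : Red A t) (s : StepD t t') : Red A t' := (red_cr A).2.1 _ _ h s
theorem Red.neutral {A t} (hn : Neutral t) (h : ∀ t', StepD t t' → Red A t') : Red A t :=
  (red_cr A).2.2 _ hn h
theorem Red.var {A} (n : ℕ) : Red A (.var n) :=
  Red.neutral trivial (by rintro _ (h | h); cases h)

theorem sn_body {A B t} (h : ∀ a, Red A a → Red B (t.subst1 a)) : SN t :=
  SN.of_subst (h _ (Red.var 0)).sn

theorem red_lam {A B t} (h : ∀ a, Red A a → Red B (t.subst1 a)) : Red (.arr A B) (.lam t) := by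
  intro s hs
  have ht : SN t := sn_body h
  have hs' := hs.sn
  induction ht generalizing s with
  | intro t _ ih =>
    induction hs' with
    | intro s hs' ih2 =>
      refine Red.neutral trivial fun q hq => ?_
      cases hq with
      | base hb => cases hb; exact h _ hs
      | appL hq =>
        cases hq with
        | base hb => cases hb
        | lam hq => exact ih _ hq (fun a ha => (h a ha).step (step_subst hq _)) _ hs ⟨_, hs'⟩
      | appR hq => exact ih2 _ hq (hs.step hq)

theorem red_pair {A B t s} (ht : Red A t) (hs : Red B s) : Red (.prod A B) (.pair t s) := by
  have ht' := ht.sn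
  have hs' := hs.sn
  induction ht' generalizing s with
  | intro t _ ih =>
    induction hs' with
    | intro s hs' ih2 =>
      constructor
      · refine Red.neutral trivial fun q hq => ?_
        cases hq with
        | base hb => cases hb; exact ht
        | proj1 hq =>
          cases hq with
          | base hb => cases hb
          | pairL hq => exact (ih _ hq (ht.step hq) hs ⟨_, hs'⟩).1
          | pairR hq => exact (ih2 _ hq (hs.step hq)).1
      · refine Red.neutral trivial fun q hq => ?_
        cases hq with
        | base hb => cases hb; exact hs
        | proj2 hq =>
          cases hq with
          | base hb => cases hb
          | pairL hq => exact (ih _ hq (ht.step hq) hs ⟨_, hs'⟩).2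
          | pairR hq => exact (ih2 _ hq (hs.step hq)).2

theorem red_inl {A B t} (ht : Red A t) : Red (.sum A B) (.inl t) := by
  have ht' := ht.sn
  induction ht' with
  | intro t _ ih =>
    have key : ∀ q, StepD (.inl t) q → Red (.sum A B) q := by
      intro q hq
      cases hq with
      | base hb => cases hb
      | inl hq => exact ih _ hq (ht.step hq)
    refine ⟨⟨_, fun q hq => (key q hq).1⟩, fun u hu => ?_, fun u hu => ?_⟩
    · rcases Relation.ReflTransGen.cases_head hu with h | ⟨q, hq, hs⟩
      · cases h; exact ht
      · exact (key q hq).2.1 u hs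
    · rcases Relation.ReflTransGen.cases_head hu with h | ⟨q, hq, hs⟩
      · cases h
      · exact (key q hq).2.2 u hs

theorem red_inr {A B t} (ht : Red B t) : Red (.sum A B) (.inr t) := by
  have ht' := ht.sn
  induction ht' with
  | intro t _ ih =>
    have key : ∀ q, StepD (.inr t) q → Red (.sum A B) q := by
      intro q hq
      cases hq with
      | base hb => cases hb
      | inr hq => exact ih _ hq (ht.step hq)
    refine ⟨⟨_, fun q hq => (key q hq).1⟩, fun u hu => ?_, fun u hu => ?_⟩
    · rcases Relation.ReflTransGen.cases_head hu with h | ⟨q, hq, hs⟩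
      · cases h
      · exact (key q hq).2.1 u hs
    · rcases Relation.ReflTransGen.cases_head hu with h | ⟨q, hq, hs⟩
      · cases h; exact ht
      · exact (key q hq).2.2 u hs

theorem red_case {A B C t a b} (ht : Red (.sum A B) t) (ha : ∀ u, Red A u → Red C (a.subst1 u))
    (hb : ∀ u, Red B u → Red C (b.subst1 u)) : Red C (.case t a b) := by
  have ht' := ht.sn
  have ha' := sn_body ha
  have hb' := sn_body hb
  induction ht' generalizing a b with
  | intro t _ ih =>
    induction ha' generalizing b with
    | intro a ha' ih2 =>
      induction hb' with
      | intro b hb' ih3 =>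
        refine Red.neutral trivial fun q hq => ?_
        cases hq with
        | base h =>
          cases h with
          | caseInl => exact ha _ (ht.2.1 _ .refl)
          | caseInr => exact hb _ (ht.2.2 _ .refl)
        | case1 hq => exact ih _ hq (ht.step hq) ha hb ⟨_, ha'⟩ ⟨_, hb'⟩
        | case2 hq =>
          exact ih2 _ hq (fun u hu => (ha u hu).step (step_subst hq _)) hb ⟨_, hb'⟩
        | case3 hq => exact ih3 _ hq (fun u hu => (hb u hu).step (step_subst hq _))

/-- Bodies of boxes all of whose reducible instances are reducible. -/
def GoodBody (B : Ty) : List Ty → Tm → Prop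
  | [], s => Red B s
  | A :: As, s => ∀ a, Red A a → GoodBody B As (s.subst (boxSigma As.length 0 (As.length + 1) a))

theorem merge_sn {B us As} (h : List.Forall₂ (fun u A => Red (.box A) u) us As) :
    ∀ {l₁ l₂ r s}, GoodBody B As s → (∀ b, Red B b → SN (merge l₁ l₂ r [] b)) →
      SN (merge l₁ l₂ r us s) := by
  induction h with
  | nil => intro l₁ l₂ r s hs H; exact H _ hs
  | @cons u A us As hu hus ih =>
    intro l₁ l₂ r s hs H
    have hlen := hus.length_eq
    have := hu l₁ (us ++ l₂) (r.subst (boxSigma l₂.length (u :: us).length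
      (l₁.length + 1 + l₂.length) s)) fun a ha => by
        have := ih (hs a ha) H
        unfold merge at this ⊢
        rw [← hlen] at this
        rw [sigma_nest (k := us.length) (m' := us.length)]
        · simpa using this
        all_goals simp
        all_goals omega
    simpa [merge] using this

theorem red_box {B us As s} (h : List.Forall₂ (fun u A => Red (.box A) u) us As)
    (hs : GoodBody B As s) : Red (.box B) (.box us s) := by
  have h1 : SN (.box us s) := by
    rw [← merge_self]
    refine merge_sn h hs fun b hb => ?_
    rw [merge_self]; exact sn_box_nil hb.sn
  intro l₁ l₂ r H
  exact expansion h1 rfl (merge_sn h hs H)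

/-- Cons for substitutions. -/
def scons (a : Tm) (σ : ℕ → Tm) : ℕ → Tm
  | 0 => a
  | j + 1 => σ j

/-- Reducible substitutions. -/
def RedSub (Γ : List Ty) (σ : ℕ → Tm) : Prop := ∀ n A, Γ[n]? = some A → Red A (σ n)

theorem RedSub.cons {Γ σ A a} (h : RedSub Γ σ) (ha : Red A a) : RedSub (A :: Γ) (scons a σ) := by
  intro n B hn
  cases n with
  | zero => simp at hn; subst hn; exact ha
  | succ n => exact h n B (by simpa using hn)

theorem subst1_lift (t a : Tm) (σ : ℕ → Tm) :
    (t.subst (liftSub 1 σ)).subst1 a = t.subst (scons a σ) := by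
  simp only [Tm.subst1, subst_subst]
  refine subst_congr _ fun j => ?_
  cases j with
  | zero => simp [liftSub, Tm.subst, scons]
  | succ j => simp [liftSub, rename_subst, subst_var, scons]

theorem lift_sigma (s a : Tm) (σ : ℕ → Tm) (m : ℕ) :
    (s.subst (liftSub (m + 1) σ)).subst (boxSigma m 0 (m + 1) a) =
      s.subst (liftSub m (scons a σ)) := by
  rw [subst_subst]
  refine subst_congr _ fun j => ?_
  rcases lt_trichotomy j m with h | h | h
  · have : j < m + 1 := by omega
    simp [liftSub, boxSigma, Tm.subst, *]
  · subst h
    simp only [liftSub, boxSigma, Tm.subst, scons, lt_irrefl, if_false, if_true,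
      Nat.lt_succ_self, Nat.sub_self]
    congr 1
  · obtain ⟨k, rfl⟩ : ∃ k, j = m + 1 + k := ⟨j - (m + 1), by omega⟩
    have a1 : ¬ m + 1 + k < m := by omega
    have a2 : m + 1 + k - m = k + 1 := by omega
    simp only [liftSub, a1, a2, if_false, scons]
    simp only [show ¬ m + 1 + k < m + 1 by omega, if_false, rename_subst, Nat.add_sub_cancel_left]
    rw [rename_eq_subst]
    refine subst_congr _ fun l => ?_
    simp only [boxSigma]
    split_ifs <;> first | omega | rfl | (congr 1; omega)

theorem goodBody {B : Ty} {s : Tm} (As : List Ty) : ∀ {Γ σ}, RedSub Γ σ →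
    (∀ σ, RedSub (As.reverse ++ Γ) σ → Red B (s.subst σ)) →
    GoodBody B As (s.subst (liftSub As.length σ)) := by
  induction As with
  | nil =>
    intro Γ σ hσ h
    have : liftSub 0 σ = σ := by funext j; simp [liftSub, rename_id]
    simp only [List.length_nil, this]
    exact h σ hσ
  | cons A As ih =>
    intro Γ σ hσ h a ha
    rw [List.length_cons, lift_sigma]
    exact ih (hσ.cons ha) fun σ' hσ' => h σ' (by simpa using hσ')

theorem fundamental {Γ t A} (h : Typing Γ t A) : ∀ σ, RedSub Γ σ → Red A (t.subst σ) := by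
  induction h with
  | var h => intro σ hσ; simpa [Tm.subst] using hσ _ _ h
  | lam _ ih =>
    intro σ hσ; simp only [Tm.subst]
    exact red_lam fun a ha => by rw [subst1_lift]; exact ih _ (hσ.cons ha)
  | app _ _ ih1 ih2 => intro σ hσ; simp only [Tm.subst]; exact ih1 σ hσ _ (ih2 σ hσ)
  | pair _ _ ih1 ih2 => intro σ hσ; simp only [Tm.subst]; exact red_pair (ih1 σ hσ) (ih2 σ hσ)
  | proj1 _ ih => intro σ hσ; simp only [Tm.subst]; exact (ih σ hσ).1
  | proj2 _ ih => intro σ hσ; simp only [Tm.subst]; exact (ih σ hσ).2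
  | inl _ ih => intro σ hσ; simp only [Tm.subst]; exact red_inl (ih σ hσ)
  | inr _ ih => intro σ hσ; simp only [Tm.subst]; exact red_inr (ih σ hσ)
  | case _ _ _ ih1 ih2 ih3 =>
    intro σ hσ; simp only [Tm.subst]
    exact red_case (ih1 σ hσ) (fun a ha => by rw [subst1_lift]; exact ih2 _ (hσ.cons ha))
      (fun a ha => by rw [subst1_lift]; exact ih3 _ (hσ.cons ha))
  | box hlen _ _ ih1 ih2 =>
    intro σ hσ
    rw [subst_box]
    refine red_box ?_ (by rw [hlen]; exact goodBody _ hσ ih2)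
    rw [List.forall₂_map_left_iff, List.forall₂_iff_zip]
    exact ⟨hlen, fun {a b} hab => ih1 (a, b) hab σ hσ⟩

/-- **Strong normalization of detour reduction** on well-typed terms: there is no infinite
sequence of `>_D`-steps starting from a term typable in some context (every typable term is
accessible for the converse of `>_D`). -/
theorem strong_normalization_detour :
    ∀ t : Tm, (∃ Γ A, Typing Γ t A) → Acc (fun a b : Tm => StepD b a) t := by
  rintro t ⟨Γ, A, h⟩
  have := fundamental h Tm.var (fun n A _ => Red.var n)
  rw [subst_var] at this
  exact this.sn

end IEL
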